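/- arXiv:2409.01697 — 2 statements merged into one kernel-verified Lean document; each statement's English description precedes it below -/
import Mathlib

section
/- If x* is a local-nonglobal minimizer of (GTR) and μ* ≥ 0 is a Lagrangian multiplier satisfying the stationarity condition (A₀x* + b₀) + μ*(A₁x* + b₁) = 0, then μ* > 0. -/
open Matrix Finset

/-- Euclidean norm of a vector in `Fin n → ℝ`. -/
noncomputable def euclNorm {n : ℕ} (x : Fin n → ℝ) : ℝ := Real.sqrt (x ⬝ᵥ x)

/-- Objective `f₀(x) = xᵀA₀x + 2b₀ᵀx`. -/
noncomputable def qf0 {n : ℕ} (A0 : Matrix (Fin n) (Fin n) ℝ) (b0 : Fin n → ℝ)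
    (x : Fin n → ℝ) : ℝ := x ⬝ᵥ A0.mulVec x + 2 * (b0 ⬝ᵥ x)

/-- Constraint `f₁(x) = xᵀA₁x + 2b₁ᵀx + c₁`. -/
noncomputable def qf1 {n : ℕ} (A1 : Matrix (Fin n) (Fin n) ℝ) (b1 : Fin n → ℝ) (c1 : ℝ)
    (x : Fin n → ℝ) : ℝ := x ⬝ᵥ A1.mulVec x + 2 * (b1 ⬝ᵥ x) + c1

/-- Local minimizer of (GTRE): feasible, and locally optimal among feasible points. -/
def IsLocalMinGTRE {n : ℕ} (A0 A1 : Matrix (Fin n) (Fin n) ℝ) (b0 b1 : Fin n → ℝ) (c1 : ℝ)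
    (xs : Fin n → ℝ) : Prop :=
  qf1 A1 b1 c1 xs = 0 ∧ ∃ δ > (0:ℝ), ∀ x : Fin n → ℝ,
    qf1 A1 b1 c1 x = 0 → euclNorm (x - xs) < δ → qf0 A0 b0 xs ≤ qf0 A0 b0 x

/-- Global minimizer of (GTRE). -/
def IsGlobalMinGTRE {n : ℕ} (A0 A1 : Matrix (Fin n) (Fin n) ℝ) (b0 b1 : Fin n → ℝ) (c1 : ℝ)
    (xs : Fin n → ℝ) : Prop :=
  qf1 A1 b1 c1 xs = 0 ∧ ∀ x : Fin n → ℝ, qf1 A1 b1 c1 x = 0 → qf0 A0 b0 xs ≤ qf0 A0 b0 x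

/-- Local-nonglobal minimizer of (GTRE). -/
def IsLNGMinGTRE {n : ℕ} (A0 A1 : Matrix (Fin n) (Fin n) ℝ) (b0 b1 : Fin n → ℝ) (c1 : ℝ)
    (xs : Fin n → ℝ) : Prop :=
  IsLocalMinGTRE A0 A1 b0 b1 c1 xs ∧ ¬ IsGlobalMinGTRE A0 A1 b0 b1 c1 xs

/-- Strict local minimizer of (GTRE). -/
def IsStrictLocalMinGTRE {n : ℕ} (A0 A1 : Matrix (Fin n) (Fin n) ℝ) (b0 b1 : Fin n → ℝ)
    (c1 : ℝ) (xs : Fin n → ℝ) : Prop :=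
  qf1 A1 b1 c1 xs = 0 ∧ ∃ δ > (0:ℝ), ∀ x : Fin n → ℝ,
    qf1 A1 b1 c1 x = 0 → x ≠ xs → euclNorm (x - xs) < δ → qf0 A0 b0 xs < qf0 A0 b0 x

/-- Strict local-nonglobal minimizer of (GTRE). -/
def IsStrictLNGMinGTRE {n : ℕ} (A0 A1 : Matrix (Fin n) (Fin n) ℝ) (b0 b1 : Fin n → ℝ)
    (c1 : ℝ) (xs : Fin n → ℝ) : Prop :=
  IsStrictLocalMinGTRE A0 A1 b0 b1 c1 xs ∧ ¬ IsGlobalMinGTRE A0 A1 b0 b1 c1 xs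

/-- Local minimizer of (GTR). -/
def IsLocalMinGTR {n : ℕ} (A0 A1 : Matrix (Fin n) (Fin n) ℝ) (b0 b1 : Fin n → ℝ) (c1 : ℝ)
    (xs : Fin n → ℝ) : Prop :=
  qf1 A1 b1 c1 xs ≤ 0 ∧ ∃ δ > (0:ℝ), ∀ x : Fin n → ℝ,
    qf1 A1 b1 c1 x ≤ 0 → euclNorm (x - xs) < δ → qf0 A0 b0 xs ≤ qf0 A0 b0 x

/-- Global minimizer of (GTR). -/
def IsGlobalMinGTR {n : ℕ} (A0 A1 : Matrix (Fin n) (Fin n) ℝ) (b0 b1 : Fin n → ℝ) (c1 : ℝ)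
    (xs : Fin n → ℝ) : Prop :=
  qf1 A1 b1 c1 xs ≤ 0 ∧ ∀ x : Fin n → ℝ, qf1 A1 b1 c1 x ≤ 0 → qf0 A0 b0 xs ≤ qf0 A0 b0 x

/-- Local-nonglobal minimizer of (GTR). -/
def IsLNGMinGTR {n : ℕ} (A0 A1 : Matrix (Fin n) (Fin n) ℝ) (b0 b1 : Fin n → ℝ) (c1 : ℝ)
    (xs : Fin n → ℝ) : Prop :=
  IsLocalMinGTR A0 A1 b0 b1 c1 xs ∧ ¬ IsGlobalMinGTR A0 A1 b0 b1 c1 xs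

/-- Strict local minimizer of (GTR). -/
def IsStrictLocalMinGTR {n : ℕ} (A0 A1 : Matrix (Fin n) (Fin n) ℝ) (b0 b1 : Fin n → ℝ)
    (c1 : ℝ) (xs : Fin n → ℝ) : Prop :=
  qf1 A1 b1 c1 xs ≤ 0 ∧ ∃ δ > (0:ℝ), ∀ x : Fin n → ℝ,
    qf1 A1 b1 c1 x ≤ 0 → x ≠ xs → euclNorm (x - xs) < δ → qf0 A0 b0 xs < qf0 A0 b0 x

/-- Strict local-nonglobal minimizer of (GTR). -/
def IsStrictLNGMinGTR {n : ℕ} (A0 A1 : Matrix (Fin n) (Fin n) ℝ) (b0 b1 : Fin n → ℝ)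
    (c1 : ℝ) (xs : Fin n → ℝ) : Prop :=
  IsStrictLocalMinGTR A0 A1 b0 b1 c1 xs ∧ ¬ IsGlobalMinGTR A0 A1 b0 b1 c1 xs

lemma euclNorm_smul {n : ℕ} (t : ℝ) (d : Fin n → ℝ) : euclNorm (t • d) = |t| * euclNorm d := by
  unfold euclNorm
  rw [smul_dotProduct, dotProduct_smul, smul_eq_mul, smul_eq_mul, ← mul_assoc,
    Real.sqrt_mul (mul_self_nonneg t), Real.sqrt_mul_self_eq_abs]

/-- Taylor expansion of a quadratic function along a line. -/
lemma qf0_add_smul {n : ℕ} {A : Matrix (Fin n) (Fin n) ℝ} (hA : A.IsSymm) (b x d : Fin n → ℝ)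
    (t : ℝ) :
    qf0 A b (x + t • d) =
      qf0 A b x + 2 * t * ((A.mulVec x + b) ⬝ᵥ d) + t ^ 2 * (d ⬝ᵥ A.mulVec d) := by
  have h : x ⬝ᵥ A.mulVec d = A.mulVec x ⬝ᵥ d := by
    rw [dotProduct_mulVec, ← mulVec_transpose, hA.eq]
  have h' : d ⬝ᵥ A.mulVec x = A.mulVec x ⬝ᵥ d := dotProduct_comm _ _
  simp only [qf0, mulVec_add, mulVec_smul, dotProduct_add, add_dotProduct, dotProduct_smul,
    smul_dotProduct, smul_eq_mul, h, h']
  ring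

lemma qf1_eq_qf0_add {n : ℕ} (A : Matrix (Fin n) (Fin n) ℝ) (b : Fin n → ℝ) (c : ℝ)
    (x : Fin n → ℝ) : qf1 A b c x = qf0 A b x + c := rfl

/-- A univariate quadratic that is nonpositive at `0` and `1` is nonpositive at one of `± s`,
for every `s ∈ (0, 1]`. -/
lemma exists_abs_eq_quadratic_nonpos {c g a s : ℝ} (h0 : c ≤ 0) (h1 : c + 2 * g + a ≤ 0)
    (hs : 0 < s) (hs1 : s ≤ 1) : ∃ t : ℝ, |t| = s ∧ c + 2 * t * g + t ^ 2 * a ≤ 0 := by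
  rcases le_total 0 a with ha | ha
  · refine ⟨s, abs_of_pos hs, ?_⟩
    nlinarith [mul_nonneg (mul_nonneg hs.le (sub_nonneg.2 hs1)) ha,
      mul_nonneg hs.le (sub_nonneg.2 h1), mul_nonneg (sub_nonneg.2 hs1) (sub_nonneg.2 h0)]
  · have hsa : s ^ 2 * a ≤ 0 := mul_nonpos_of_nonneg_of_nonpos (sq_nonneg s) ha
    rcases le_total 0 g with hg | hg
    · refine ⟨-s, by rw [abs_neg, abs_of_pos hs], ?_⟩
      nlinarith [mul_nonneg hs.le hg]
    · refine ⟨s, abs_of_pos hs, ?_⟩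
      nlinarith [mul_nonneg hs.le (sub_nonneg.2 hg)]

/-- A local minimizer of (GTR) that is a critical point of the objective is a global minimizer. -/
lemma IsLocalMinGTR.isGlobalMinGTR_of_critical {n : ℕ} {A0 A1 : Matrix (Fin n) (Fin n) ℝ}
    (hA0 : A0.IsSymm) (hA1 : A1.IsSymm) {b0 b1 : Fin n → ℝ} {c1 : ℝ} {xs : Fin n → ℝ}
    (h : IsLocalMinGTR A0 A1 b0 b1 c1 xs) (hcrit : A0.mulVec xs + b0 = 0) :
    IsGlobalMinGTR A0 A1 b0 b1 c1 xs := by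
  obtain ⟨hfeas, δ, hδ, hmin⟩ := h
  refine ⟨hfeas, fun x hx => ?_⟩
  obtain ⟨d, rfl⟩ : ∃ d, x = xs + (1 : ℝ) • d := ⟨x - xs, by simp⟩
  have hd : 0 ≤ euclNorm d := Real.sqrt_nonneg _
  have hs : 0 < min 1 (δ / (euclNorm d + 1)) := by positivity
  rw [qf1_eq_qf0_add, qf0_add_smul hA1] at hx
  obtain ⟨t, ht, hq⟩ := exists_abs_eq_quadratic_nonpos
    (g := (A1.mulVec xs + b1) ⬝ᵥ d) (a := d ⬝ᵥ A1.mulVec d) hfeas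
    (by rw [qf1_eq_qf0_add]; linarith) hs (min_le_left _ _)
  have hnorm : euclNorm (xs + t • d - xs) < δ := by
    rw [add_sub_cancel_left, euclNorm_smul]
    have hle : |t| * (euclNorm d + 1) ≤ δ := by
      rw [ht, ← le_div_iff₀ (by positivity)]
      exact min_le_right _ _
    have hpos : 0 < |t| := ht ▸ hs
    linarith
  have hloc := hmin (xs + t • d)
    (by rw [qf1_eq_qf0_add] at hq ⊢; rw [qf0_add_smul hA1]; linarith) hnorm
  rw [qf0_add_smul hA0, hcrit, zero_dotProduct] at hloc ⊢
  have ht2 : 0 < t ^ 2 := sq_pos_of_ne_zero (abs_pos.1 (ht ▸ hs))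
  have : 0 ≤ d ⬝ᵥ A0.mulVec d := nonneg_of_mul_nonneg_right (by linarith) ht2
  linarith

theorem stmt3 {n : ℕ} (hn : 1 ≤ n)
    (A0 A1 : Matrix (Fin n) (Fin n) ℝ) (hA0 : A0.IsSymm) (hA1 : A1.IsSymm)
    (b0 b1 : Fin n → ℝ) (c1 : ℝ) (xs : Fin n → ℝ) (μ : ℝ)
    (hx : IsLNGMinGTR A0 A1 b0 b1 c1 xs)
    (hμ : 0 ≤ μ)
    (hstat : (A0.mulVec xs + b0) + μ • (A1.mulVec xs + b1) = 0) :
    0 < μ := by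
  refine hμ.lt_of_ne ?_
  rintro rfl
  exact hx.2 (hx.1.isGlobalMinGTR_of_critical hA0 hA1 (by simpa using hstat))
end

section
/- If x* is a local-nonglobal minimizer of (GTRE) or of (GTR), then there exists a Lagrangian multiplier μ* ∈ ℝ such that (A₀x* + b₀) + μ*(A₁x* + b₁) = 0 and vᵀ(A₀ + μ*A₁)v ≥ 0 for every v ∈ ℝⁿ with (A₁x* + b₁)ᵀv = 0; moreover, every nonzero vector v̄ ∈ ℝⁿ satisfying (A₁x* + b₁)ᵀv̄ = 0 and v̄ᵀ(A₀ + μ*A₁)v̄ = 0 must satisfy v̄ᵀA₀v̄ = 0 and v̄ᵀA₁v̄ = 0. -/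
open Matrix Finset

section Limits

open Filter Topology

/-- Nonnegativity near `0` of `t ^ 2 * h t` passes to `h 0`. -/
lemma nonneg_of_eventually_sq_mul {h : ℝ → ℝ} (hc : ContinuousAt h 0)
    (hh : ∀ᶠ t in 𝓝 (0 : ℝ), 0 ≤ t ^ 2 * h t) : 0 ≤ h 0 := by
  refine ge_of_tendsto (hc.tendsto.mono_left (nhdsWithin_le_nhds (s := Set.Ioi 0))) ?_
  filter_upwards [hh.filter_mono nhdsWithin_le_nhds, self_mem_nhdsWithin] with t ht htpos
  exact nonneg_of_mul_nonneg_right ht (pow_pos htpos 2)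

/-- Nonnegativity near `0` of `t * h t` forces `h 0 = 0`. -/
lemma eq_zero_of_eventually_mul_nonneg {h : ℝ → ℝ} (hc : ContinuousAt h 0)
    (hh : ∀ᶠ t in 𝓝 (0 : ℝ), 0 ≤ t * h t) : h 0 = 0 := by
  apply le_antisymm
  · refine le_of_tendsto (hc.tendsto.mono_left (nhdsWithin_le_nhds (s := Set.Iio 0))) ?_
    filter_upwards [hh.filter_mono nhdsWithin_le_nhds, self_mem_nhdsWithin] with t ht htneg
    have : t < 0 := htneg
    nlinarith
  · refine ge_of_tendsto (hc.tendsto.mono_left (nhdsWithin_le_nhds (s := Set.Ioi 0))) ?_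
    filter_upwards [hh.filter_mono nhdsWithin_le_nhds, self_mem_nhdsWithin] with t ht htpos
    exact nonneg_of_mul_nonneg_right ht htpos

/-- The small root of `c t² σ² + 2 (1 + b t) σ + a = 0`, as a function of `t` near `0`. -/
lemma exists_continuousAt_quadratic_root (a b c : ℝ) :
    ∃ σ : ℝ → ℝ, ContinuousAt σ 0 ∧ σ 0 = -a / 2 ∧
      ∀ᶠ t in 𝓝 (0 : ℝ), a + 2 * b * t * σ t + c * t ^ 2 * σ t ^ 2 + 2 * σ t = 0 := by
  set q : ℝ → ℝ := fun t => (1 + b * t) ^ 2 - c * a * t ^ 2 with hq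
  set D : ℝ → ℝ := fun t => (1 + b * t) + √(q t) with hD
  have hqc : Continuous q := by fun_prop
  have hDc : Continuous D := by fun_prop
  have hq0 : q 0 = 1 := by simp [hq]
  have hD0 : D 0 = 2 := by simp [hD, hq0]; norm_num
  refine ⟨fun t => -a / D t, ?_, by simp [hD0], ?_⟩
  · exact continuousAt_const.div hDc.continuousAt (by rw [hD0]; norm_num)
  · have h1 : ∀ᶠ t in 𝓝 (0 : ℝ), 0 < q t :=
      hqc.continuousAt.eventually (lt_mem_nhds (by rw [hq0]; norm_num))
    have h2 : ∀ᶠ t in 𝓝 (0 : ℝ), 0 < D t :=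
      hDc.continuousAt.eventually (lt_mem_nhds (by rw [hD0]; norm_num))
    filter_upwards [h1, h2] with t hqt hDt
    have hs : (D t - (1 + b * t)) ^ 2 = (1 + b * t) ^ 2 - c * a * t ^ 2 := by
      simp only [hD, add_sub_cancel_left]
      exact Real.sq_sqrt hqt.le
    field_simp
    linear_combination a * hs

end Limits

section Quadratic

open Filter Topology

variable {n : ℕ}

lemma dotProduct_mulVec_comm_of_isSymm {A : Matrix (Fin n) (Fin n) ℝ} (hA : A.IsSymm)
    (v w : Fin n → ℝ) : w ⬝ᵥ A.mulVec v = v ⬝ᵥ A.mulVec w := by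
  rw [dotProduct_mulVec, dotProduct_comm, ← mulVec_transpose, hA.eq]

lemma quadForm_combination {A : Matrix (Fin n) (Fin n) ℝ} (hA : A.IsSymm)
    (v w : Fin n → ℝ) (t s : ℝ) :
    (t • v + s • w) ⬝ᵥ A.mulVec (t • v + s • w) =
      t ^ 2 * (v ⬝ᵥ A.mulVec v) + 2 * t * s * (v ⬝ᵥ A.mulVec w)
        + s ^ 2 * (w ⬝ᵥ A.mulVec w) := by
  simp only [mulVec_add, mulVec_smul, add_dotProduct, dotProduct_add, smul_dotProduct,
    dotProduct_smul, smul_eq_mul, dotProduct_mulVec_comm_of_isSymm hA v w]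
  ring

lemma quadForm_add_smul (A B : Matrix (Fin n) (Fin n) ℝ) (μ : ℝ) (d : Fin n → ℝ) :
    d ⬝ᵥ (A + μ • B).mulVec d = d ⬝ᵥ A.mulVec d + μ * (d ⬝ᵥ B.mulVec d) := by
  simp [add_mulVec, smul_mulVec, dotProduct_add]

lemma quadForm_smul (A : Matrix (Fin n) (Fin n) ℝ) (d : Fin n → ℝ) (t : ℝ) :
    (t • d) ⬝ᵥ A.mulVec (t • d) = t ^ 2 * (d ⬝ᵥ A.mulVec d) := by
  simp only [mulVec_smul, smul_dotProduct, dotProduct_smul, smul_eq_mul]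
  ring

lemma qf0_add {A : Matrix (Fin n) (Fin n) ℝ} (hA : A.IsSymm) (b x d : Fin n → ℝ) :
    qf0 A b (x + d) =
      qf0 A b x + (d ⬝ᵥ A.mulVec d + 2 * ((A.mulVec x + b) ⬝ᵥ d)) := by
  have h := quadForm_combination hA x d 1 1
  simp only [one_smul] at h
  rw [qf0, qf0, h, dotProduct_add, add_dotProduct, dotProduct_comm (A.mulVec x) d,
    dotProduct_mulVec_comm_of_isSymm hA x d]
  ring

lemma qf1_add {A : Matrix (Fin n) (Fin n) ℝ} (hA : A.IsSymm) (b : Fin n → ℝ) (c : ℝ)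
    (x d : Fin n → ℝ) :
    qf1 A b c (x + d) =
      qf1 A b c x + (d ⬝ᵥ A.mulVec d + 2 * ((A.mulVec x + b) ⬝ᵥ d)) := by
  have h := qf0_add hA b x d
  simp only [qf0] at h
  simp only [qf1]
  linarith

lemma continuous_euclNorm : Continuous (euclNorm : (Fin n → ℝ) → ℝ) := by
  unfold euclNorm
  fun_prop

lemma eventually_euclNorm_lt {δ : ℝ} (hδ : 0 < δ) :
    ∀ᶠ d in 𝓝 (0 : Fin n → ℝ), euclNorm d < δ :=
  continuous_euclNorm.continuousAt.eventually (gt_mem_nhds (by simpa [euclNorm] using hδ))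

/-- On a set stable under real scaling, a quadratic function that is nonnegative near `0` is
nonnegative everywhere. -/
lemma nonneg_of_eventually_nonneg_of_cone {A : Matrix (Fin n) (Fin n) ℝ} {g : Fin n → ℝ}
    {C : Set (Fin n → ℝ)} (hC : ∀ d ∈ C, ∀ t : ℝ, t • d ∈ C)
    (h : ∀ᶠ d in 𝓝 (0 : Fin n → ℝ), d ∈ C → 0 ≤ d ⬝ᵥ A.mulVec d + 2 * (g ⬝ᵥ d)) :
    ∀ d ∈ C, 0 ≤ d ⬝ᵥ A.mulVec d + 2 * (g ⬝ᵥ d) := by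
  intro d hd
  have hl : Tendsto (fun t : ℝ => t • d) (𝓝 0) (𝓝 0) := by
    have : Continuous (fun t : ℝ => t • d) := by fun_prop
    simpa using this.tendsto 0
  have ht : ∀ᶠ t in 𝓝 (0 : ℝ), 0 ≤ t ^ 2 * (d ⬝ᵥ A.mulVec d) + 2 * (t * (g ⬝ᵥ d)) := by
    filter_upwards [hl.eventually h] with t ht
    simpa only [quadForm_smul, dotProduct_smul, smul_eq_mul] using ht (hC d hd t)
  have h1 : g ⬝ᵥ d = 0 := by
    have := eq_zero_of_eventually_mul_nonneg
      (h := fun t => t * (d ⬝ᵥ A.mulVec d) + 2 * (g ⬝ᵥ d)) (by fun_prop)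
      (ht.mono fun t ht => by linarith)
    simpa using this
  have h2 : 0 ≤ d ⬝ᵥ A.mulVec d := by
    refine nonneg_of_eventually_sq_mul (h := fun _ => d ⬝ᵥ A.mulVec d) (by fun_prop)
      (ht.mono fun t ht => ?_)
    simpa [h1] using ht
  simpa [h1] using h2

/-- A local minimality condition on the quadric `dᵀBd + 2gᵀd = 0`, restricted to a curve with
initial velocity `v` tangent to the quadric. -/
lemma exists_curve_nonneg {A B : Matrix (Fin n) (Fin n) ℝ} (hA : A.IsSymm) (hB : B.IsSymm)
    {f g : Fin n → ℝ}
    (h : ∀ᶠ d in 𝓝 (0 : Fin n → ℝ), d ⬝ᵥ B.mulVec d + 2 * (g ⬝ᵥ d) = 0 →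
      0 ≤ d ⬝ᵥ A.mulVec d + 2 * (f ⬝ᵥ d))
    {v w : Fin n → ℝ} (hv : g ⬝ᵥ v = 0) (hw : g ⬝ᵥ w = 1) :
    ∃ σ : ℝ → ℝ, ContinuousAt σ 0 ∧ σ 0 = -(v ⬝ᵥ B.mulVec v) / 2 ∧
      ∀ᶠ t in 𝓝 (0 : ℝ), 0 ≤ t ^ 2 * (v ⬝ᵥ A.mulVec v) + 2 * t ^ 3 * σ t * (v ⬝ᵥ A.mulVec w)
        + t ^ 4 * σ t ^ 2 * (w ⬝ᵥ A.mulVec w) + 2 * t * (f ⬝ᵥ v)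
        + 2 * t ^ 2 * σ t * (f ⬝ᵥ w) := by
  obtain ⟨σ, hσ, hσ0, hroot⟩ := exists_continuousAt_quadratic_root (v ⬝ᵥ B.mulVec v)
    (v ⬝ᵥ B.mulVec w) (w ⬝ᵥ B.mulVec w)
  refine ⟨σ, hσ, hσ0, ?_⟩
  have hl : Tendsto (fun t : ℝ => t • v + (t ^ 2 * σ t) • w) (𝓝 0) (𝓝 0) := by
    have : ContinuousAt (fun t : ℝ => t • v + (t ^ 2 * σ t) • w) 0 := by fun_prop
    simpa using this.tendsto
  filter_upwards [hl.eventually h, hroot] with t ht hr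
  rw [quadForm_combination hA, quadForm_combination hB] at ht
  simp only [dotProduct_add, dotProduct_smul, smul_eq_mul, hv, hw] at ht
  have := ht (by linear_combination t ^ 2 * hr)
  linarith

lemma exists_dotProduct_eq_one {g : Fin n → ℝ} (hg : g ≠ 0) : ∃ w, g ⬝ᵥ w = 1 :=
  ⟨(g ⬝ᵥ g)⁻¹ • g, by
    rw [dotProduct_smul, smul_eq_mul, inv_mul_cancel₀ (mt dotProduct_self_eq_zero.1 hg)]⟩

/-- First-order necessary condition at a point of a quadric with nonzero gradient `g`. -/
lemma exists_multiplier {A B : Matrix (Fin n) (Fin n) ℝ} (hA : A.IsSymm) (hB : B.IsSymm)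
    {f g : Fin n → ℝ} (hg : g ≠ 0)
    (h : ∀ᶠ d in 𝓝 (0 : Fin n → ℝ), d ⬝ᵥ B.mulVec d + 2 * (g ⬝ᵥ d) = 0 →
      0 ≤ d ⬝ᵥ A.mulVec d + 2 * (f ⬝ᵥ d)) :
    ∃ μ : ℝ, f + μ • g = 0 := by
  obtain ⟨w, hw⟩ := exists_dotProduct_eq_one hg
  have tangent : ∀ v, g ⬝ᵥ v = 0 → f ⬝ᵥ v = 0 := by
    intro v hv
    obtain ⟨σ, hσ, -, ht⟩ := exists_curve_nonneg hA hB h hv hw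
    have := eq_zero_of_eventually_mul_nonneg
      (h := fun t => t * (v ⬝ᵥ A.mulVec v) + 2 * t ^ 2 * σ t * (v ⬝ᵥ A.mulVec w)
        + t ^ 3 * σ t ^ 2 * (w ⬝ᵥ A.mulVec w) + 2 * (f ⬝ᵥ v)
        + 2 * t * σ t * (f ⬝ᵥ w)) (by fun_prop) (ht.mono fun t ht => by linarith)
    simpa using this
  have hgg : g ⬝ᵥ g ≠ 0 := mt dotProduct_self_eq_zero.1 hg
  refine ⟨-(f ⬝ᵥ g) / (g ⬝ᵥ g), ?_⟩
  set μ := -(f ⬝ᵥ g) / (g ⬝ᵥ g) with hμ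
  have h1 : g ⬝ᵥ (f + μ • g) = 0 := by
    rw [dotProduct_add, dotProduct_smul, smul_eq_mul, hμ, div_mul_cancel₀ _ hgg,
      dotProduct_comm]
    ring
  rw [← dotProduct_self_eq_zero, add_dotProduct, smul_dotProduct, h1, tangent _ h1]
  simp

/-- Second-order conditions for a quadratic form `M` that is nonnegative on a quadric near a point
with nonzero gradient `g`: `M` is nonnegative on the tangent space, and if it vanishes at a tangent
vector along which the quadric is curved, then it is nonnegative everywhere. -/
lemma nonneg_of_eventually_nonneg_on_quadric {M B : Matrix (Fin n) (Fin n) ℝ} (hM : M.IsSymm)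
    (hB : B.IsSymm) {g : Fin n → ℝ} (hg : g ≠ 0)
    (h : ∀ᶠ d in 𝓝 (0 : Fin n → ℝ), d ⬝ᵥ B.mulVec d + 2 * (g ⬝ᵥ d) = 0 →
      0 ≤ d ⬝ᵥ M.mulVec d) :
    (∀ v, g ⬝ᵥ v = 0 → 0 ≤ v ⬝ᵥ M.mulVec v) ∧
      ∀ v, g ⬝ᵥ v = 0 → v ⬝ᵥ M.mulVec v = 0 → v ⬝ᵥ B.mulVec v ≠ 0 →
        ∀ d, 0 ≤ d ⬝ᵥ M.mulVec d := by
  have h' : ∀ᶠ d in 𝓝 (0 : Fin n → ℝ), d ⬝ᵥ B.mulVec d + 2 * (g ⬝ᵥ d) = 0 →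
      0 ≤ d ⬝ᵥ M.mulVec d + 2 * ((0 : Fin n → ℝ) ⬝ᵥ d) := by simpa using h
  have tangent : ∀ v, g ⬝ᵥ v = 0 → 0 ≤ v ⬝ᵥ M.mulVec v := by
    intro v hv
    obtain ⟨w, hw⟩ := exists_dotProduct_eq_one hg
    obtain ⟨σ, hσ, -, ht⟩ := exists_curve_nonneg hM hB h' hv hw
    have := nonneg_of_eventually_sq_mul
      (h := fun t => (v ⬝ᵥ M.mulVec v) + 2 * t * σ t * (v ⬝ᵥ M.mulVec w)
        + t ^ 2 * σ t ^ 2 * (w ⬝ᵥ M.mulVec w)) (by fun_prop)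
      (ht.mono fun t ht => by simp only [zero_dotProduct] at ht; linarith)
    simpa using this
  refine ⟨tangent, fun v hv hMv hBv => ?_⟩
  have transversal : ∀ w, g ⬝ᵥ w = 1 → 0 ≤ w ⬝ᵥ M.mulVec w := by
    intro w hw
    obtain ⟨σ, hσ, hσ0, ht⟩ := exists_curve_nonneg hM hB h' hv hw
    simp only [hMv, zero_dotProduct] at ht
    have hσ0' : σ 0 ≠ 0 := by
      rw [hσ0]
      simpa using hBv
    have hvw : v ⬝ᵥ M.mulVec w = 0 := by
      have key := eq_zero_of_eventually_mul_nonneg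
        (h := fun t => 2 * σ t * (v ⬝ᵥ M.mulVec w) + t * σ t ^ 2 * (w ⬝ᵥ M.mulVec w))
        (by fun_prop)
        (ht.mono fun t ht => by
          rcases eq_or_ne t 0 with rfl | ht0
          · simp
          · refine nonneg_of_mul_nonneg_right (a := t ^ 2) ?_ (by positivity)
            linarith)
      simpa [hσ0'] using key
    have key := nonneg_of_eventually_sq_mul
      (h := fun t => σ t ^ 2 * (w ⬝ᵥ M.mulVec w)) (by fun_prop)
      (ht.mono fun t ht => by
        rcases eq_or_ne t 0 with rfl | ht0
        · simp
        · refine nonneg_of_mul_nonneg_right (a := t ^ 2) ?_ (by positivity)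
          rw [hvw] at ht
          linarith)
    exact nonneg_of_mul_nonneg_right key (by positivity)
  intro d
  by_cases hd : g ⬝ᵥ d = 0
  · exact tangent d hd
  · have := transversal ((g ⬝ᵥ d)⁻¹ • d) (by
      rw [dotProduct_smul, smul_eq_mul, inv_mul_cancel₀ hd])
    rw [quadForm_smul] at this
    exact nonneg_of_mul_nonneg_right this (by positivity)

/-- If `f = -μ g` and `0` minimizes `dᵀAd + 2fᵀd` locally on `dᵀBd + 2gᵀd ≤ 0` with `g ≠ 0`, then
`μ` is nonnegative. -/
lemma multiplier_nonneg {A B : Matrix (Fin n) (Fin n) ℝ} {f g : Fin n → ℝ} (hg : g ≠ 0)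
    {μ : ℝ} (hμ : f + μ • g = 0)
    (h : ∀ᶠ d in 𝓝 (0 : Fin n → ℝ), d ⬝ᵥ B.mulVec d + 2 * (g ⬝ᵥ d) ≤ 0 →
      0 ≤ d ⬝ᵥ A.mulVec d + 2 * (f ⬝ᵥ d)) :
    0 ≤ μ := by
  obtain ⟨w, hw⟩ := exists_dotProduct_eq_one hg
  have hfw : f ⬝ᵥ w = -μ := by
    rw [eq_neg_of_add_eq_zero_left hμ, neg_dotProduct, smul_dotProduct, hw]
    simp
  have hl : Tendsto (fun t : ℝ => (-t) • w) (𝓝[>] 0) (𝓝 0) := by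
    have : Continuous (fun t : ℝ => (-t) • w) := by fun_prop
    simpa using (this.tendsto 0).mono_left (nhdsWithin_le_nhds (s := Set.Ioi 0))
  have hneg : ∀ᶠ t in 𝓝[>] (0 : ℝ), t * (w ⬝ᵥ B.mulVec w) - 2 < 0 := by
    have : Continuous (fun t : ℝ => t * (w ⬝ᵥ B.mulVec w) - 2) := by fun_prop
    exact (this.continuousAt.eventually (gt_mem_nhds (by simp))).filter_mono nhdsWithin_le_nhds
  have hlim : Tendsto (fun t : ℝ => t * (w ⬝ᵥ A.mulVec w) + 2 * μ) (𝓝[>] 0) (𝓝 (2 * μ)) := by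
    have : Continuous (fun t : ℝ => t * (w ⬝ᵥ A.mulVec w) + 2 * μ) := by fun_prop
    simpa using (this.tendsto 0).mono_left (nhdsWithin_le_nhds (s := Set.Ioi 0))
  have : 0 ≤ 2 * μ := by
    refine ge_of_tendsto hlim ?_
    filter_upwards [hl.eventually h, hneg, self_mem_nhdsWithin] with t ht hn htpos
    have htpos : 0 < t := htpos
    rw [quadForm_smul, quadForm_smul, dotProduct_smul, dotProduct_smul, hw, hfw] at ht
    simp only [smul_eq_mul] at ht
    have := ht (by nlinarith)
    refine nonneg_of_mul_nonneg_right (a := t) ?_ htpos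
    linarith
  linarith

/-- Optimality conditions at a local minimizer `0` of `dᵀAd + 2fᵀd` on the quadric
`dᵀBd + 2gᵀd = 0`, when a positive semidefinite Lagrangian is excluded. -/
lemma optimality_conditions {A B : Matrix (Fin n) (Fin n) ℝ} (hA : A.IsSymm) (hB : B.IsSymm)
    {f g : Fin n → ℝ} (hg : g ≠ 0)
    (h : ∀ᶠ d in 𝓝 (0 : Fin n → ℝ), d ⬝ᵥ B.mulVec d + 2 * (g ⬝ᵥ d) = 0 →
      0 ≤ d ⬝ᵥ A.mulVec d + 2 * (f ⬝ᵥ d))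
    (hnot : ∀ μ : ℝ, f + μ • g = 0 → ¬ ∀ d, 0 ≤ d ⬝ᵥ (A + μ • B).mulVec d) :
    ∃ μ : ℝ, f + μ • g = 0 ∧ (∀ v, g ⬝ᵥ v = 0 → 0 ≤ v ⬝ᵥ (A + μ • B).mulVec v) ∧
      ∀ v, v ≠ 0 → g ⬝ᵥ v = 0 → v ⬝ᵥ (A + μ • B).mulVec v = 0 →
        v ⬝ᵥ A.mulVec v = 0 ∧ v ⬝ᵥ B.mulVec v = 0 := by
  obtain ⟨μ, hμ⟩ := exists_multiplier hA hB hg h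
  have hM : ∀ᶠ d in 𝓝 (0 : Fin n → ℝ), d ⬝ᵥ B.mulVec d + 2 * (g ⬝ᵥ d) = 0 →
      0 ≤ d ⬝ᵥ (A + μ • B).mulVec d := by
    filter_upwards [h] with d hd hfeas
    have hfd := congrArg (· ⬝ᵥ d) hμ
    simp only [add_dotProduct, smul_dotProduct, smul_eq_mul, zero_dotProduct] at hfd
    have := hd hfeas
    rw [quadForm_add_smul]
    linear_combination this - μ * hfeas + 2 * hfd
  obtain ⟨h1, h2⟩ := nonneg_of_eventually_nonneg_on_quadric (hA.add (hB.smul μ)) hB hg hM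
  refine ⟨μ, hμ, h1, fun v _ hv hv0 => ?_⟩
  have hBv : v ⬝ᵥ B.mulVec v = 0 := by
    by_contra hBv
    exact hnot μ hμ (h2 v hv hv0 hBv)
  rw [quadForm_add_smul, hBv] at hv0
  exact ⟨by simpa using hv0, hBv⟩

end Quadratic

theorem stmt5 {n : ℕ} (hn : 1 ≤ n)
    (A0 A1 : Matrix (Fin n) (Fin n) ℝ) (hA0 : A0.IsSymm) (hA1 : A1.IsSymm)
    (b0 b1 : Fin n → ℝ) (c1 : ℝ) (xs : Fin n → ℝ)
    (hx : IsLNGMinGTRE A0 A1 b0 b1 c1 xs ∨ IsLNGMinGTR A0 A1 b0 b1 c1 xs) :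
    ∃ μ : ℝ,
      (A0.mulVec xs + b0) + μ • (A1.mulVec xs + b1) = 0 ∧
      (∀ v : Fin n → ℝ, (A1.mulVec xs + b1) ⬝ᵥ v = 0 →
        0 ≤ v ⬝ᵥ (A0 + μ • A1).mulVec v) ∧
      (∀ v : Fin n → ℝ, v ≠ 0 → (A1.mulVec xs + b1) ⬝ᵥ v = 0 →
        v ⬝ᵥ (A0 + μ • A1).mulVec v = 0 →
        v ⬝ᵥ A0.mulVec v = 0 ∧ v ⬝ᵥ A1.mulVec v = 0) := by
  set g0 := A0.mulVec xs + b0 with hg0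
  set g1 := A1.mulVec xs + b1 with hg1
  have e0 : ∀ d, qf0 A0 b0 (xs + d) = qf0 A0 b0 xs + (d ⬝ᵥ A0.mulVec d + 2 * (g0 ⬝ᵥ d)) :=
    qf0_add hA0 b0 xs
  have e1 : ∀ d, qf1 A1 b1 c1 (xs + d) =
      qf1 A1 b1 c1 xs + (d ⬝ᵥ A1.mulVec d + 2 * (g1 ⬝ᵥ d)) := qf1_add hA1 b1 c1 xs
  have lagrangian : ∀ μ : ℝ, g0 + μ • g1 = 0 → ∀ d, d ⬝ᵥ A0.mulVec d + 2 * (g0 ⬝ᵥ d) =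
      d ⬝ᵥ (A0 + μ • A1).mulVec d - μ * (d ⬝ᵥ A1.mulVec d + 2 * (g1 ⬝ᵥ d)) := by
    intro μ hμ d
    have hd := congrArg (· ⬝ᵥ d) hμ
    simp only [add_dotProduct, smul_dotProduct, smul_eq_mul, zero_dotProduct] at hd
    rw [quadForm_add_smul]
    linear_combination 2 * hd
  rcases hx with ⟨⟨hf, δ, hδ, hloc⟩, hng⟩ | ⟨⟨hf, δ, hδ, hloc⟩, hng⟩
  · have hng' : ¬ ∀ d, d ⬝ᵥ A1.mulVec d + 2 * (g1 ⬝ᵥ d) = 0 →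
        0 ≤ d ⬝ᵥ A0.mulVec d + 2 * (g0 ⬝ᵥ d) := by
      refine fun H => hng ⟨hf, fun x hx => ?_⟩
      have h0 := e0 (x - xs)
      have h1 := e1 (x - xs)
      rw [add_sub_cancel] at h0 h1
      linarith [H (x - xs) (by linarith)]
    have h : ∀ᶠ d in nhds (0 : Fin n → ℝ), d ⬝ᵥ A1.mulVec d + 2 * (g1 ⬝ᵥ d) = 0 →
        0 ≤ d ⬝ᵥ A0.mulVec d + 2 * (g0 ⬝ᵥ d) := by
      filter_upwards [eventually_euclNorm_lt hδ] with d hd hfeas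
      have := hloc (xs + d) (by rw [e1]; linarith) (by simpa using hd)
      rw [e0] at this
      linarith
    refine optimality_conditions hA0 hA1 (fun hg => hng' ?_) h fun μ hμ hpsd => hng' ?_
    · rw [hg] at h ⊢
      refine nonneg_of_eventually_nonneg_of_cone
        (C := {d | d ⬝ᵥ A1.mulVec d + 2 * ((0 : Fin n → ℝ) ⬝ᵥ d) = 0}) ?_ h
      intro d hd t
      simp only [zero_dotProduct, mul_zero, add_zero, Set.mem_ofPred_eq] at hd ⊢
      rw [quadForm_smul, hd, mul_zero]
    · intro d hd
      rw [lagrangian μ hμ, hd, mul_zero, sub_zero]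
      exact hpsd d
  · have hng' : ¬ ∀ d, qf1 A1 b1 c1 (xs + d) ≤ 0 → 0 ≤ d ⬝ᵥ A0.mulVec d + 2 * (g0 ⬝ᵥ d) := by
      refine fun H => hng ⟨hf, fun x hx => ?_⟩
      have h0 := e0 (x - xs)
      rw [add_sub_cancel] at h0
      linarith [H (x - xs) (by rwa [add_sub_cancel])]
    have h : ∀ᶠ d in nhds (0 : Fin n → ℝ), qf1 A1 b1 c1 (xs + d) ≤ 0 →
        0 ≤ d ⬝ᵥ A0.mulVec d + 2 * (g0 ⬝ᵥ d) := by
      filter_upwards [eventually_euclNorm_lt hδ] with d hd hfeas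
      have := hloc (xs + d) hfeas (by simpa using hd)
      rw [e0] at this
      linarith
    have hactive : qf1 A1 b1 c1 xs = 0 := by
      refine hf.antisymm (not_lt.1 fun hlt => hng' fun d _ => ?_)
      refine nonneg_of_eventually_nonneg_of_cone (C := Set.univ) (by simp) ?_ d trivial
      have hc : Continuous fun d => qf1 A1 b1 c1 (xs + d) := by
        unfold qf1
        fun_prop
      filter_upwards [h, hc.continuousAt.eventually (gt_mem_nhds (by simpa using hlt))]
        with d hd hneg _ using hd hneg.le
    simp only [e1, hactive, zero_add] at h hng'
    have hg : g1 ≠ 0 := by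
      refine fun hg => hng' ?_
      rw [hg] at h ⊢
      refine nonneg_of_eventually_nonneg_of_cone
        (C := {d | d ⬝ᵥ A1.mulVec d + 2 * ((0 : Fin n → ℝ) ⬝ᵥ d) ≤ 0}) ?_ h
      intro d hd t
      simp only [zero_dotProduct, mul_zero, add_zero, Set.mem_ofPred_eq] at hd ⊢
      rw [quadForm_smul]
      exact mul_nonpos_of_nonneg_of_nonpos (sq_nonneg t) hd
    refine optimality_conditions hA0 hA1 hg (h.mono fun d hd hfeas => hd hfeas.le)
      fun μ hμ hpsd => hng' fun d hd => ?_
    rw [lagrangian μ hμ]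
    nlinarith [hpsd d, multiplier_nonneg hg hμ h]
end
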